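/- arXiv:2211.04541 — 2 statements merged into one kernel-verified Lean document; each statement's English description precedes it below -/
import Mathlib

section
/- Let 0 < a < b be real numbers. Then there exist a set I with card(I) = 𝔠 and a linearly independent family (F^k)_{k∈I} of closed infinite-dimensional vector subspaces of ℓ^b with F^k ⊆ (ℓ^b \ ℓ^a) ∪ {0} for every k ∈ I. -/
open Filter Topology

noncomputable section

/-- The topology generated by the open balls of a distance function `d`.
When `d` is an actual metric this is precisely the metric topology. -/
def topOfDist {α : Type*} (d : α → α → ℝ) : TopologicalSpace α :=
  TopologicalSpace.generateFrom {S | ∃ x r, S = {y | d x y < r}}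

/-- The space `ℓ^p`, `0 < p < ∞`, of complex sequences. -/
def lpSet (p : ℝ) : Set (ℕ → ℂ) := {x | Summable fun n => ‖x n‖ ^ p}

/-- The metric `d^p` of `ℓ^p`: the norm metric for `p ≥ 1`, and
`d^p(x,y) = Σ |x n - y n| ^ p` for `0 < p < 1`. -/
def dlp (p : ℝ) (x y : ℕ → ℂ) : ℝ :=
  if 1 ≤ p then (∑' n, ‖x n - y n‖ ^ p) ^ (1 / p) else ∑' n, ‖x n - y n‖ ^ p

/-- The topology of `ℓ^p` induced by the metric `d^p`. -/
def lpTopology (p : ℝ) : TopologicalSpace ↥(lpSet p) :=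
  topOfDist fun x y => dlp p x.1 y.1

/-- Membership in `lpSet p` agrees with Mathlib's `Memℓp`. -/
theorem mem_lpSet_iff_memℓp {p : ℝ} (hp : 0 < p) (x : ℕ → ℂ) :
    x ∈ lpSet p ↔ Memℓp x (ENNReal.ofReal p) := by
  rw [memℓp_gen_iff (by rwa [ENNReal.toReal_ofReal hp.le]), ENNReal.toReal_ofReal hp.le]
  rfl

/-- The coordinate functionals on `ℓ^p` are continuous. -/
theorem continuous_lpSet_apply {p : ℝ} (hp : 0 < p) (n : ℕ) :
    @Continuous _ _ (lpTopology p) _ fun x : ↥(lpSet p) => x.1 n := by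
  let _ := lpTopology p
  refine continuous_iff_continuousAt.2 fun x => Metric.tendsto_nhds.2 fun ε hε => ?_
  obtain ⟨r, hr, hball⟩ : ∃ r > 0, ∀ y : ↥(lpSet p), dlp p x.1 y.1 < r → ‖x.1 n - y.1 n‖ < ε := by
    have hle (y : ↥(lpSet p)) : ‖x.1 n - y.1 n‖ ^ p ≤ ∑' m, ‖x.1 m - y.1 m‖ ^ p := by
      have hs : x.1 - y.1 ∈ lpSet p := (mem_lpSet_iff_memℓp hp _).2
        (((mem_lpSet_iff_memℓp hp _).1 x.2).sub ((mem_lpSet_iff_memℓp hp _).1 y.2))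
      exact hs.le_tsum n fun m _ => by positivity
    by_cases h1 : 1 ≤ p
    · refine ⟨ε, hε, fun y hy => lt_of_le_of_lt ?_ hy⟩
      rw [dlp, if_pos h1]
      calc ‖x.1 n - y.1 n‖ = (‖x.1 n - y.1 n‖ ^ p) ^ (1 / p) := by
            rw [one_div, Real.rpow_rpow_inv (norm_nonneg _) hp.ne']
        _ ≤ _ := Real.rpow_le_rpow (by positivity) (hle y) (by positivity)
    · refine ⟨ε ^ p, by positivity, fun y hy => ?_⟩
      rw [dlp, if_neg h1] at hy
      exact (Real.rpow_lt_rpow_iff (norm_nonneg _) hε.le hp).1 ((hle y).trans_lt hy)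
  have hopen : IsOpen {y : ↥(lpSet p) | dlp p x.1 y.1 < r} :=
    TopologicalSpace.isOpen_generateFrom_of_mem ⟨x, r, rfl⟩
  have hself : dlp p x.1 x.1 = 0 := by
    by_cases h1 : 1 ≤ p <;> simp [dlp, h1, Real.zero_rpow hp.ne', hp.ne']
  filter_upwards [hopen.mem_nhds (show dlp p x.1 x.1 < r by rwa [hself])] with y hy
  rw [dist_comm, dist_eq_norm]
  exact hball y hy

/-- The sequence `(n + 1) ^ (-t)`. -/
def powSeq (t : ℝ) (n : ℕ) : ℂ := (((n + 1 : ℝ) ^ (-t) : ℝ) : ℂ)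

theorem powSeq_zero (t : ℝ) : powSeq t 0 = 1 := by simp [powSeq]

theorem powSeq_mem_lpSet_iff {t p : ℝ} : powSeq t ∈ lpSet p ↔ 1 < t * p := by
  rw [← Real.summable_one_div_nat_rpow, ← summable_nat_add_iff 1]
  refine summable_congr fun n => ?_
  have h : (0 : ℝ) ≤ n + 1 := by positivity
  rw [powSeq, Complex.norm_real, Real.norm_of_nonneg (by positivity), ← Real.rpow_mul h,
    neg_mul, Real.rpow_neg h, Nat.cast_add_one, one_div]

theorem powSeq_two_pow_sub_one (t : ℝ) (m : ℕ) :
    powSeq t (2 ^ m - 1) = (((2 : ℝ) ^ (-t) : ℝ) : ℂ) ^ m := by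
  have h : ((2 ^ m - 1 : ℕ) : ℝ) + 1 = 2 ^ m := by
    rw [Nat.cast_sub Nat.one_le_two_pow]; simp
  rw [powSeq, h, ← Complex.ofReal_pow, ← Real.rpow_natCast, ← Real.rpow_natCast,
    ← Real.rpow_mul two_pos.le, ← Real.rpow_mul two_pos.le, mul_comm]

theorem linearIndependent_powSeq : LinearIndependent ℂ powSeq := by
  have hinj : Function.Injective fun t : ℝ => powersHom ℂ (((2 : ℝ) ^ (-t) : ℝ) : ℂ) := by
    refine (powersHom ℂ).injective.comp (Complex.ofReal_injective.comp fun s t h => ?_)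
    exact neg_injective ((Real.rpow_right_inj two_pos (by norm_num)).1 h)
  have hli := (linearIndependent_monoidHom (Multiplicative ℕ) ℂ).comp _ hinj
  have heq : LinearMap.funLeft ℂ ℂ (fun m : Multiplicative ℕ => 2 ^ m.toAdd - 1) ∘ powSeq =
      fun t : ℝ => ⇑(powersHom ℂ (((2 : ℝ) ^ (-t) : ℝ) : ℂ)) := by
    ext t m
    simp [LinearMap.funLeft_apply, powSeq_two_pow_sub_one, powersHom_apply]
  refine LinearIndependent.of_comp
    (LinearMap.funLeft ℂ ℂ fun m : Multiplicative ℕ => 2 ^ m.toAdd - 1) ?_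
  rw [heq]
  exact hli

/-- The sequences in `ℓ^p` which, read as double sequences through the pairing `ℕ × ℕ ≃ ℕ`,
have all their rows proportional to `powSeq t`. -/
def rowSubmodule {p : ℝ} (hp : 0 < p) (t : ℝ) : Submodule ℂ (ℕ → ℂ) where
  carrier := {v | v ∈ lpSet p ∧ ∀ i n, v (Nat.pair i n) = v (Nat.pair i 0) * powSeq t n}
  add_mem' := by
    rintro v w ⟨hv, hv'⟩ ⟨hw, hw'⟩
    rw [mem_lpSet_iff_memℓp hp] at hv hw
    refine ⟨(mem_lpSet_iff_memℓp hp _).2 (hv.add hw), fun i n => ?_⟩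
    rw [Pi.add_apply, Pi.add_apply, hv', hw', add_mul]
  zero_mem' := ⟨(mem_lpSet_iff_memℓp hp _).2 zero_memℓp, by simp⟩
  smul_mem' := by
    rintro c v ⟨hv, hv'⟩
    rw [mem_lpSet_iff_memℓp hp] at hv
    refine ⟨(mem_lpSet_iff_memℓp hp _).2 (hv.const_smul c), fun i n => ?_⟩
    rw [Pi.smul_apply, Pi.smul_apply, hv', smul_mul_assoc]

theorem isClosed_rowSubmodule {p : ℝ} (hp : 0 < p) (t : ℝ) :
    @IsClosed ↥(lpSet p) (lpTopology p)
      (Subtype.val ⁻¹' (rowSubmodule hp t : Set (ℕ → ℂ))) := by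
  let _ := lpTopology p
  have h : (Subtype.val ⁻¹' (rowSubmodule hp t : Set (ℕ → ℂ)) : Set ↥(lpSet p)) =
      ⋂ i, ⋂ n, {v | v.1 (Nat.pair i n) = v.1 (Nat.pair i 0) * powSeq t n} := by
    ext v
    simp only [Set.mem_iInter]
    exact and_iff_right v.2
  rw [h]
  exact isClosed_iInter fun i => isClosed_iInter fun n => isClosed_eq
    (continuous_lpSet_apply hp _) ((continuous_lpSet_apply hp _).mul continuous_const)

/-- The double sequence whose `i`-th row is `powSeq t` and whose other rows vanish. -/
def rowVector (t : ℝ) (i m : ℕ) : ℂ := if m.unpair.1 = i then powSeq t m.unpair.2 else 0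

theorem rowVector_pair (t : ℝ) (i j n : ℕ) :
    rowVector t i (Nat.pair j n) = if j = i then powSeq t n else 0 := by
  simp [rowVector]

theorem injective_pair_right (i : ℕ) : Function.Injective (Nat.pair i) :=
  fun _ _ h => (Nat.pair_eq_pair.1 h).2

theorem rowVector_mem {p t : ℝ} (hp : 0 < p) (ht : 1 < t * p) (i : ℕ) :
    rowVector t i ∈ rowSubmodule hp t := by
  refine ⟨?_, fun j n => ?_⟩
  · refine ((injective_pair_right i).summable_iff fun m hm => ?_).1 ?_
    · have : m.unpair.1 ≠ i := fun h => hm ⟨m.unpair.2, by rw [← h, Nat.pair_unpair]⟩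
      simp [rowVector, this, Real.zero_rpow hp.ne']
    · refine (powSeq_mem_lpSet_iff.2 ht).congr fun n => ?_
      simp [rowVector_pair]
  · by_cases h : j = i <;> simp [rowVector_pair, h, powSeq_zero]

theorem not_finiteDimensional_rowSubmodule {p t : ℝ} (hp : 0 < p) (ht : 1 < t * p) :
    ¬ FiniteDimensional ℂ (rowSubmodule hp t) := by
  intro hfin
  have hli : LinearIndependent ℂ
      fun i => (⟨rowVector t i, rowVector_mem hp ht i⟩ : rowSubmodule hp t) := by
    refine LinearIndependent.of_comp
      (LinearMap.funLeft ℂ ℂ (fun j => Nat.pair j 0) ∘ₗ (rowSubmodule hp t).subtype) ?_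
    convert Pi.linearIndependent_single_one ℕ ℂ using 1
    ext i j
    simp [LinearMap.funLeft_apply, rowVector_pair, powSeq_zero, Pi.single_apply]
  have := hli.finite
  exact not_finite ℕ

theorem rowSubmodule_ext {p t : ℝ} {hp : 0 < p} {v : ℕ → ℂ} (hv : v ∈ rowSubmodule hp t)
    (h : ∀ i, v (Nat.pair i 0) = 0) : v = 0 := by
  ext m
  rw [← Nat.pair_unpair m, hv.2, h, zero_mul, Pi.zero_apply]

theorem eq_zero_of_mem_rowSubmodule_of_mem_lpSet {p q t : ℝ} {hp : 0 < p} (ht : t * q ≤ 1)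
    {v : ℕ → ℂ} (hv : v ∈ rowSubmodule hp t) (hvq : v ∈ lpSet q) : v = 0 := by
  refine rowSubmodule_ext hv fun i => by_contra fun hi => ht.not_gt (powSeq_mem_lpSet_iff.1 ?_)
  have hrow : Summable fun n => ‖v (Nat.pair i n)‖ ^ q :=
    hvq.comp_injective (injective_pair_right i)
  refine (summable_mul_left_iff (a := ‖v (Nat.pair i 0)‖ ^ q)
    (Real.rpow_pos_of_pos (norm_pos_iff.2 hi) q).ne').1 (hrow.congr fun n => ?_)
  rw [hv.2 i n, norm_mul, Real.mul_rpow (norm_nonneg _) (norm_nonneg _)]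

theorem rowSubmodule_independent {p : ℝ} (hp : 0 < p) {ι : Type*} {t : ι → ℝ}
    (ht : Function.Injective t) (J : Finset ι) (v : ι → ℕ → ℂ)
    (hv : ∀ k ∈ J, v k ∈ rowSubmodule hp (t k)) (hsum : ∑ k ∈ J, v k = 0) :
    ∀ k ∈ J, v k = 0 := by
  intro k hk
  refine rowSubmodule_ext (hv k hk) fun i => ?_
  refine linearIndependent_iff'.1 (linearIndependent_powSeq.comp t ht) J
    (fun k => v k (Nat.pair i 0)) ?_ k hk
  ext n
  have h := congrFun hsum (Nat.pair i n)
  rw [Finset.sum_apply] at h ⊢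
  refine Eq.trans ?_ h
  exact Finset.sum_congr rfl fun l hl => ((hv l hl).2 i n).symm

/-- Let `0 < a < b`. Then there are continuum many linearly independent closed
infinite-dimensional vector subspaces `F^k` of `ℓ^b` (with its metric topology)
with `F^k ⊆ (ℓ^b \ ℓ^a) ∪ {0}` for every `k`. -/
theorem statement11 (a b : ℝ) (ha : 0 < a) (hab : a < b) :
    ∃ (I : Type) (F : I → Submodule ℂ (ℕ → ℂ)),
      Cardinal.mk I = Cardinal.continuum ∧
      (∀ k, (F k : Set (ℕ → ℂ)) ⊆ lpSet b) ∧
      (∀ k, @IsClosed ↥(lpSet b) (lpTopology b)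
        (Subtype.val ⁻¹' (F k : Set (ℕ → ℂ)))) ∧
      (∀ k, ¬ FiniteDimensional ℂ (F k)) ∧
      (∀ (J : Finset I) (v : I → (ℕ → ℂ)), (∀ k ∈ J, v k ∈ F k) →
        (∑ k ∈ J, v k) = 0 → ∀ k ∈ J, v k = 0) ∧
      (∀ k, ∀ v ∈ F k, v ≠ 0 → v ∉ lpSet a) := by
  have hb : 0 < b := ha.trans hab
  have hlt : ∀ k : Set.Ioo (1 / b) (1 / a), 1 < k.1 * b := fun k => (div_lt_iff₀ hb).1 k.2.1
  have hle : ∀ k : Set.Ioo (1 / b) (1 / a), k.1 * a ≤ 1 := fun k => ((lt_div_iff₀ ha).1 k.2.2).le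
  exact ⟨Set.Ioo (1 / b) (1 / a), fun k => rowSubmodule hb k,
    Cardinal.mk_Ioo_real (one_div_lt_one_div_of_lt ha hab), fun _ _ hv => hv.1,
    fun k => isClosed_rowSubmodule hb k,
    fun k => not_finiteDimensional_rowSubmodule hb (hlt k),
    rowSubmodule_independent hb Subtype.val_injective,
    fun k _ hv hne hva => hne (eq_zero_of_mem_rowSubmodule_of_mem_lpSet (hle k) hv hva)⟩

end
end

section
/- Let a ∈ (0,∞). Then there exist a set I with card(I) = 𝔠 and a linearly independent family (F^k)_{k∈I} of closed infinite-dimensional vector subspaces of c₀ with F^k ⊆ (c₀ \ ℓ^a) ∪ {0} for every k ∈ I. -/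
open Filter Topology

noncomputable section

/-- The sup metric `d^∞(x,y) = sup_n |x n - y n|`. -/
def dsup (x y : ℕ → ℂ) : ℝ := ⨆ n, ‖x n - y n‖

/-- The space `ℓ^∞` of bounded complex sequences. -/
def linfSet : Set (ℕ → ℂ) := {x | ∃ C : ℝ, ∀ n, ‖x n‖ ≤ C}

/-- The space `c₀` of complex sequences tending to `0`. -/
def c0Set : Set (ℕ → ℂ) := {x | Tendsto x atTop (𝓝 0)}

theorem norm_sub_le_dsup {x y : ℕ → ℂ} (hx : x ∈ c0Set) (hy : y ∈ c0Set) (n : ℕ) :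
    ‖x n - y n‖ ≤ dsup x y := by
  have h : Tendsto (fun n => ‖x n - y n‖) atTop (𝓝 ‖(0 : ℂ) - 0‖) :=
    (Tendsto.sub hx hy).norm
  exact le_ciSup h.bddAbove_range n

theorem continuous_eval_c0Set (n : ℕ) :
    @Continuous ↥c0Set ℂ (topOfDist fun x y => dsup x.1 y.1) _ (fun x => x.1 n) := by
  let _ : TopologicalSpace ↥c0Set := topOfDist fun x y => dsup x.1 y.1
  refine continuous_iff_continuousAt.2 fun x => Metric.tendsto_nhds.2 fun ε hε => ?_
  have hopen : IsOpen {y : ↥c0Set | dsup x.1 y.1 < ε} :=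
    TopologicalSpace.isOpen_generateFrom_of_mem ⟨x, ε, rfl⟩
  have hmem : x ∈ {y : ↥c0Set | dsup x.1 y.1 < ε} := by
    simpa [dsup] using hε
  filter_upwards [hopen.mem_nhds hmem] with y hy
  rw [dist_comm, dist_eq_norm]
  exact (norm_sub_le_dsup x.2 y.2 n).trans_lt hy

/-- The null sequences which, read as a matrix through `Nat.pair`, have every row
proportional to `w` with the entry in column `0` as the factor. -/
def rowMultiples (w : ℕ → ℂ) : Submodule ℂ (ℕ → ℂ) where
  carrier := {x | x ∈ c0Set ∧ ∀ i j, x (Nat.pair i j) = x (Nat.pair i 0) * w j}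
  zero_mem' := ⟨tendsto_const_nhds, by simp⟩
  add_mem' := by
    rintro x y ⟨hx, hx'⟩ ⟨hy, hy'⟩
    refine ⟨by have h := Tendsto.add hx hy; rwa [add_zero] at h, fun i j => ?_⟩
    simp only [Pi.add_apply, hx' i j, hy' i j, add_mul]
  smul_mem' := by
    rintro c x ⟨hx, hx'⟩
    refine ⟨by have h := Tendsto.const_mul c hx; rwa [mul_zero] at h, fun i j => ?_⟩
    simp only [Pi.smul_apply, smul_eq_mul, hx' i j, mul_assoc]

theorem mem_rowMultiples {w x : ℕ → ℂ} :
    x ∈ rowMultiples w ↔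
      x ∈ c0Set ∧ ∀ i j, x (Nat.pair i j) = x (Nat.pair i 0) * w j := Iff.rfl

theorem eq_zero_of_mem_rowMultiples {w x : ℕ → ℂ} (hx : x ∈ rowMultiples w)
    (h : ∀ i, x (Nat.pair i 0) = 0) : x = 0 := by
  funext n
  rw [← Nat.pair_unpair n, hx.2, h, zero_mul, Pi.zero_apply]

theorem isClosed_rowMultiples (w : ℕ → ℂ) :
    @IsClosed ↥c0Set (topOfDist fun x y => dsup x.1 y.1)
      (Subtype.val ⁻¹' (rowMultiples w : Set (ℕ → ℂ))) := by
  let _ : TopologicalSpace ↥c0Set := topOfDist fun x y => dsup x.1 y.1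
  have h : (Subtype.val ⁻¹' (rowMultiples w : Set (ℕ → ℂ)) : Set ↥c0Set) =
      ⋂ i, ⋂ j, {x : ↥c0Set | x.1 (Nat.pair i j) = x.1 (Nat.pair i 0) * w j} := by
    ext x
    simp [mem_rowMultiples, x.2]
  rw [h]
  exact isClosed_iInter fun i => isClosed_iInter fun j =>
    isClosed_eq (continuous_eval_c0Set _) ((continuous_eval_c0Set _).mul continuous_const)

/-- The matrix whose `i`-th row is `w` and whose other rows vanish, read as a sequence. -/
def singleRow (w : ℕ → ℂ) (i n : ℕ) : ℂ :=
  if (Nat.unpair n).1 = i then w (Nat.unpair n).2 else 0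

theorem singleRow_mem_rowMultiples {w : ℕ → ℂ} (hw : w ∈ c0Set) (hw0 : w 0 = 1) (i : ℕ) :
    singleRow w i ∈ rowMultiples w := by
  refine ⟨Metric.tendsto_atTop.2 fun ε hε => ?_, fun i' j => ?_⟩
  · obtain ⟨N, hN⟩ := Metric.tendsto_atTop.1 hw ε hε
    refine ⟨Nat.pair i N, fun n hn => ?_⟩
    unfold singleRow
    split_ifs with h
    · refine hN _ (not_lt.1 fun hlt => hn.not_gt ?_)
      rw [← Nat.pair_unpair n, h]
      exact Nat.pair_lt_pair_right i hlt
    · simpa using hε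
  · simp [singleRow, hw0]

theorem not_finiteDimensional_rowMultiples {w : ℕ → ℂ} (hw : w ∈ c0Set) (hw0 : w 0 = 1) :
    ¬ FiniteDimensional ℂ (rowMultiples w) := by
  intro hfin
  have hli : LinearIndependent ℂ
      (fun i => (⟨singleRow w i, singleRow_mem_rowMultiples hw hw0 i⟩ : rowMultiples w)) := by
    refine linearIndependent_iff'.2 fun s g hg i hi => ?_
    have h := congrFun (congrArg Subtype.val hg) (Nat.pair i 0)
    simp only [Submodule.coe_sum, Submodule.coe_smul, Finset.sum_apply, Pi.smul_apply,
      singleRow, Nat.unpair_pair, hw0, smul_eq_mul, mul_ite, mul_one, mul_zero,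
      Finset.sum_ite_eq, hi, if_true] at h
    exact h
  exact not_finite_iff_infinite.2 inferInstance hli.finite

theorem notMem_lpSet_of_mem_rowMultiples {a : ℝ} {w x : ℕ → ℂ} (hw : w ∉ lpSet a)
    (hx : x ∈ rowMultiples w) (hx0 : x ≠ 0) : x ∉ lpSet a := by
  intro hsum
  obtain ⟨i, hi⟩ : ∃ i, x (Nat.pair i 0) ≠ 0 := by
    by_contra! h
    exact hx0 (eq_zero_of_mem_rowMultiples hx h)
  have hinj : Function.Injective (Nat.pair i) := fun j j' h => (Nat.pair_eq_pair.1 h).2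
  have h : Summable fun j => ‖x (Nat.pair i 0)‖ ^ a * ‖w j‖ ^ a := by
    refine (Summable.comp_injective hsum hinj).congr fun j => ?_
    rw [Function.comp_apply, hx.2 i j, norm_mul,
      Real.mul_rpow (norm_nonneg _) (norm_nonneg _)]
  exact hw ((summable_mul_left_iff (Real.rpow_pos_of_pos (norm_pos_iff.2 hi) a).ne').1 h)

theorem eq_zero_of_sum_rowMultiples_eq_zero {I : Type*} {w : I → ℕ → ℂ}
    (hw : LinearIndependent ℂ w) (J : Finset I) (v : I → ℕ → ℂ)
    (hv : ∀ k ∈ J, v k ∈ rowMultiples (w k)) (hsum : ∑ k ∈ J, v k = 0) :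
    ∀ k ∈ J, v k = 0 := by
  intro k hk
  refine eq_zero_of_mem_rowMultiples (hv k hk) fun i => ?_
  refine linearIndependent_iff'.1 hw J (fun k => v k (Nat.pair i 0)) ?_ k hk
  funext j
  have h := congrFun hsum (Nat.pair i j)
  simp only [Finset.sum_apply, Pi.zero_apply] at h
  simp only [Finset.sum_apply, Pi.smul_apply, smul_eq_mul, Pi.zero_apply]
  rw [← h]
  exact Finset.sum_congr rfl fun k hk => ((hv k hk).2 i j).symm

/-- The sequence `n ↦ (n + 1) ^ (-s)`. -/
def powerSeq (s : ℝ) (n : ℕ) : ℂ := (((n + 1 : ℕ) : ℝ) ^ (-s) : ℝ)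

theorem powerSeq_zero (s : ℝ) : powerSeq s 0 = 1 := by simp [powerSeq]

theorem powerSeq_mem_c0Set {s : ℝ} (hs : 0 < s) : powerSeq s ∈ c0Set := by
  have h := ((tendsto_rpow_neg_atTop hs).comp tendsto_natCast_atTop_atTop).comp
    (tendsto_add_atTop_nat 1)
  have h' := (Complex.continuous_ofReal.tendsto 0).comp h
  rwa [Complex.ofReal_zero] at h'

theorem powerSeq_notMem_lpSet {a s : ℝ} (hs : s * a ≤ 1) : powerSeq s ∉ lpSet a := by
  intro h
  have h' : Summable fun n : ℕ => ((n + 1 : ℕ) : ℝ) ^ (-s * a) := by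
    refine Summable.congr h fun n => ?_
    rw [powerSeq, Complex.norm_real, Real.norm_of_nonneg (by positivity),
      Real.rpow_mul (by positivity)]
  have := Real.summable_nat_rpow.1
    ((summable_nat_add_iff (f := fun n : ℕ => (n : ℝ) ^ (-s * a)) 1).1 h')
  linarith

/-- The character `n ↦ n ^ (-s)` of the multiplicative monoid of positive integers. -/
def powerHom (s : ℝ) : ℕ+ →* ℂ where
  toFun n := (((n : ℕ) : ℝ) ^ (-s) : ℝ)
  map_one' := by simp
  map_mul' m n := by
    rw [PNat.mul_coe, Nat.cast_mul, Real.mul_rpow (by positivity) (by positivity),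
      Complex.ofReal_mul]

theorem powerHom_injective : Function.Injective powerHom := by
  intro s t h
  have h2 := DFunLike.congr_fun h 2
  have h2' : (2 : ℝ) ^ (-s) = (2 : ℝ) ^ (-t) := Complex.ofReal_injective h2
  have := (Real.rpow_right_inj (by norm_num) (by norm_num)).1 h2'
  linarith

theorem linearIndependent_powerSeq : LinearIndependent ℂ powerSeq := by
  have h := (linearIndependent_monoidHom ℕ+ ℂ).comp powerHom powerHom_injective
  refine linearIndependent_iff'.2 fun s g hg => linearIndependent_iff'.1 h s g ?_
  funext n
  have hn := congrFun hg n.natPred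
  simp only [Finset.sum_apply, Pi.smul_apply, powerSeq, PNat.natPred_add_one] at hn
  rw [Finset.sum_apply]
  exact hn

/-- Let `a ∈ (0,∞)`. Then there are continuum many linearly independent closed
infinite-dimensional vector subspaces `F^k` of `c₀` (with the sup metric) with
`F^k ⊆ (c₀ \ ℓ^a) ∪ {0}` for every `k`. -/
theorem statement17 (a : ℝ) (ha : 0 < a) :
    ∃ (I : Type) (F : I → Submodule ℂ (ℕ → ℂ)),
      Cardinal.mk I = Cardinal.continuum ∧
      (∀ k, (F k : Set (ℕ → ℂ)) ⊆ c0Set) ∧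
      (∀ k, @IsClosed ↥c0Set (topOfDist fun x y => dsup x.1 y.1)
        (Subtype.val ⁻¹' (F k : Set (ℕ → ℂ)))) ∧
      (∀ k, ¬ FiniteDimensional ℂ (F k)) ∧
      (∀ (J : Finset I) (v : I → (ℕ → ℂ)), (∀ k ∈ J, v k ∈ F k) →
        (∑ k ∈ J, v k) = 0 → ∀ k ∈ J, v k = 0) ∧
      (∀ k, ∀ v ∈ F k, v ≠ 0 → v ∉ lpSet a) := by
  refine ⟨Set.Ioc 0 (1 / a), fun k => rowMultiples (powerSeq k), ?_, fun k x hx => hx.1,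
    fun k => isClosed_rowMultiples _,
    fun k => not_finiteDimensional_rowMultiples (powerSeq_mem_c0Set k.2.1) (powerSeq_zero _),
    fun J v hv hsum => eq_zero_of_sum_rowMultiples_eq_zero
      (linearIndependent_powerSeq.comp _ Subtype.val_injective) J v hv hsum,
    fun k v hv hv0 => notMem_lpSet_of_mem_rowMultiples
      (powerSeq_notMem_lpSet ((le_div_iff₀ ha).1 k.2.2)) hv hv0⟩
  exact Cardinal.mk_Ioc_real (by positivity)

end
end
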